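/- Let D ⊆ ℂⁿ be a B-regular bounded domain and A ⊆ ∂D b-pluripolar. Suppose F and K are compact subsets of cl(D) with F ⊆ Â and K ⊆ cl(D) \ Â. Then for every C > 0 there exists ψ ∈ PSH(D) ∩ C(cl(D)) with ψ < 0 on cl(D), ψ < -C on F, and ψ > -1 on K. -/

import Mathlib

open Complex Metric MeasureTheory Filter Topology Set

noncomputable section

/-- The average of the truncation `max u (-m)` of an `EReal`-valued function `u` over the
circle of center `c` and radius `r`. -/
noncomputable def truncCircleAvg (u : ℂ → EReal) (c : ℂ) (r : ℝ) (m : ℕ) : ℝ :=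
  (2 * Real.pi)⁻¹ *
    ∫ θ in (0:ℝ)..(2 * Real.pi),
      (max (u (c + (r : ℂ) * Complex.exp (θ * Complex.I))) ((-(m : ℝ) : ℝ) : EReal)).toReal

/-- A `[-∞,∞]`-valued function is subharmonic on `U ⊆ ℂ` if it is upper semicontinuous
on `U` and satisfies the sub-mean value inequality on every closed disc contained in `U`
(expressed via averages of truncations from below). -/
def SubharmonicOn (u : ℂ → EReal) (U : Set ℂ) : Prop :=
  UpperSemicontinuousOn u U ∧
    ∀ c r, 0 < r → Metric.closedBall c r ⊆ U →
      ∀ m : ℕ, u c ≤ ((truncCircleAvg u c r m : ℝ) : EReal)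

variable {E : Type*} [NormedAddCommGroup E] [NormedSpace ℂ E]

/-- Plurisubharmonic on `D`: upper semicontinuous on `D`, with values in `[-∞, ∞)`,
whose restriction to every complex line is subharmonic.  (The constant `-∞` is allowed
here; the paper's class `PSH(D)` additionally requires `u ≢ -∞`, see `MemPSH`.) -/
def PshOn (u : E → EReal) (D : Set E) : Prop :=
  UpperSemicontinuousOn u D ∧ (∀ z ∈ D, u z ≠ ⊤) ∧
    ∀ a b : E, SubharmonicOn (fun ζ : ℂ => u (a + ζ • b)) {ζ : ℂ | a + ζ • b ∈ D}

/-- Membership in the paper's class `PSH(D)`: plurisubharmonic and not identically `-∞`. -/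
def MemPSH (u : E → EReal) (D : Set E) : Prop :=
  PshOn u D ∧ ∃ z ∈ D, u z ≠ ⊥

/-- The upper semicontinuous regularization `u*` of `u` on `cl(D)`:
`u*(x) = limsup_{z → x, z ∈ D} u(z)`. -/
noncomputable def uscReg (u : E → EReal) (D : Set E) (x : E) : EReal :=
  Filter.limsup u (nhdsWithin x D)

/-- The boundary relative extremal function
`ω(z, A, D) = sup { u(z) : u ∈ PSH(D), u ≤ 0 on D, u* ≤ -1 on A }`. -/
noncomputable def bndExt (z : E) (A D : Set E) : EReal :=
  sSup {w : EReal | ∃ u : E → EReal, MemPSH u D ∧ (∀ y ∈ D, u y ≤ 0) ∧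
    (∀ x ∈ A, uscReg u D x ≤ -1) ∧ w = u z}

/-- The upper semicontinuous regularization `ω*(·, A, D)` on `cl(D)`. -/
noncomputable def bndExtStar (x : E) (A D : Set E) : EReal :=
  Filter.limsup (fun z => bndExt z A D) (nhdsWithin x D)

/-- A bounded domain: a nonempty connected bounded open set. -/
def IsBddDomain (D : Set E) : Prop :=
  IsOpen D ∧ IsConnected D ∧ Bornology.IsBounded D

/-- `A ⊆ ∂D` is b-pluripolar if there is `u ∈ PSH(D)`, `u ≤ 0`, `u ≢ -∞`,
with `u* = -∞` on `A`. -/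
def BPluripolar (A D : Set E) : Prop :=
  ∃ u : E → EReal, PshOn u D ∧ (∀ z ∈ D, u z ≤ 0) ∧ (∃ z ∈ D, u z ≠ ⊥) ∧
    ∀ x ∈ A, uscReg u D x = ⊥

/-- The b-pluripolar hull `Â` of `A ⊆ ∂D`: all points `z ∈ cl(D)` such that `u*(z) = -∞`
for every negative `u ∈ PSH(D)`, `u ≢ -∞`, with `u* = -∞` on `A`. -/
def bHull (A D : Set E) : Set E :=
  {z ∈ closure D | ∀ u : E → EReal, PshOn u D → (∀ y ∈ D, u y < 0) →
    (∃ y ∈ D, u y ≠ ⊥) → (∀ x ∈ A, uscReg u D x = ⊥) → uscReg u D z = ⊥}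

/-- Weak regularity: for every relatively open `U ⊆ ∂D` one has `ω*(·, U, D) ≤ -1` on `U`. -/
def WeaklyRegular (D : Set E) : Prop :=
  ∀ U W : Set E, IsOpen W → U = W ∩ frontier D → ∀ x ∈ U, bndExtStar x U D ≤ -1

/-- B-regularity (Sibony): every continuous `f : ∂D → ℝ` extends to a function
plurisubharmonic on `D` and continuous on `cl(D)` with boundary values `f`. -/
def BRegular (D : Set E) : Prop :=
  ∀ f : E → ℝ, ContinuousOn f (frontier D) →
    ∃ F : E → ℝ, ContinuousOn F (closure D) ∧
      PshOn (fun z => ((F z : ℝ) : EReal)) D ∧ ∀ x ∈ frontier D, F x = f x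

/-- The extremal function `ω₁(z, K, D)`, defined with continuous-up-to-the-boundary
plurisubharmonic competitors. -/
noncomputable def bndExtCont (z : E) (K D : Set E) : EReal :=
  sSup {w : EReal | ∃ F : E → ℝ, ContinuousOn F (closure D) ∧
    PshOn (fun y => ((F y : ℝ) : EReal)) D ∧ (∀ y ∈ closure D, F y ≤ 0) ∧
    (∀ x ∈ K, F x ≤ -1) ∧ w = ((F z : ℝ) : EReal)}

end


/-- Comparison form of plurisubharmonicity, on parametrised unit discs. -/
def SubCmp {E : Type*} [NormedAddCommGroup E] [NormedSpace ℂ E] (v : E → ℝ) (U : Set E) : Prop :=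
  ∀ a b : E, (∀ ζ : ℂ, ‖ζ‖ ≤ 1 → a + ζ • b ∈ U) → ∀ g : ℂ → ℂ, Differentiable ℂ g →
    (∀ ζ : ℂ, ‖ζ‖ = 1 → v (a + ζ • b) ≤ (g ζ).re) → v a ≤ (g 0).re

lemma aux_mean (g : ℂ → ℂ) (hg : Differentiable ℂ g) :
    (2 * Real.pi)⁻¹ * ∫ θ in (0:ℝ)..(2 * Real.pi), (g (Complex.exp (θ * Complex.I))).re
      = (g 0).re := by
  have h := DiffContOnCl.circleAverage (c := 0) (R := 1) (f := g) hg.diffContOnCl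
  rw [Real.circleAverage_def] at h
  have hc : Continuous fun θ : ℝ => g (circleMap 0 1 θ) :=
    hg.continuous.comp (continuous_circleMap 0 1)
  have h2 := Complex.reCLM.intervalIntegral_comp_comm (μ := volume)
    (hc.intervalIntegrable 0 (2 * Real.pi))
  rw [← h, Complex.smul_re, smul_eq_mul]
  congr 1
  simp only [Complex.reCLM_apply, circleMap, zero_add, Complex.ofReal_one, one_mul] at h2 ⊢
  exact h2

lemma aux_norm_exp (θ : ℝ) : ‖Complex.exp (θ * Complex.I)‖ = 1 := Complex.norm_exp_ofReal_mul_I θ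

/-- Circle continuity. -/
lemma aux_circ_cont {w : ℂ → ℝ} (hw : ContinuousOn w (Metric.sphere 0 1)) :
    Continuous fun θ : ℝ => w (Complex.exp (θ * Complex.I)) := by
  refine hw.comp_continuous (by fun_prop) ?_
  intro θ
  simp

lemma aux_trig (g : C(AddCircle (2 * Real.pi), ℂ))
    (hg : g ∈ Submodule.span ℂ (range (@fourier (2 * Real.pi)))) :
    ∃ P : ℂ → ℂ, Differentiable ℂ P ∧
      ∀ θ : ℝ, (g (θ : AddCircle (2 * Real.pi))).re = (P (Complex.exp (θ * Complex.I))).re := by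
  suffices H : ∀ c : ℂ, ∃ P : ℂ → ℂ, Differentiable ℂ P ∧
      ∀ θ : ℝ, (c * g (θ : AddCircle (2 * Real.pi))).re = (P (Complex.exp (θ * Complex.I))).re by
    simpa using H 1
  induction hg using Submodule.span_induction with
  | mem x hx =>
    obtain ⟨n, rfl⟩ := hx
    intro c
    have key : ∀ θ : ℝ, (fourier n (θ : AddCircle (2 * Real.pi)) : ℂ)
        = Complex.exp (n * (θ * Complex.I)) := by
      intro θ
      rw [fourier_coe_apply]
      congr 1
      have : (Real.pi : ℂ) ≠ 0 := by exact_mod_cast Real.pi_ne_zero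
      push_cast
      field_simp
    rcases Int.eq_nat_or_neg n with ⟨k, rfl | rfl⟩
    · refine ⟨fun z => c * z ^ k, by fun_prop, ?_⟩
      intro θ
      simp only [key, ← Complex.exp_nat_mul]
      simp
    · refine ⟨fun z => (starRingEnd ℂ c) * z ^ k, by fun_prop, ?_⟩
      intro θ
      simp only [key, ← Complex.exp_nat_mul]
      rw [← Complex.conj_re, map_mul, ← Complex.exp_conj]
      simp
  | zero => exact fun c => ⟨fun _ => 0, by fun_prop, by simp⟩
  | add x y _ _ hx hy =>
    intro c
    obtain ⟨P, hP, hP'⟩ := hx c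
    obtain ⟨Q, hQ, hQ'⟩ := hy c
    refine ⟨fun z => P z + Q z, by fun_prop, ?_⟩
    intro θ
    simp only [ContinuousMap.add_apply, mul_add, Complex.add_re]
    rw [← hP', ← hQ']
  | smul a x _ hx =>
    intro c
    obtain ⟨P, hP, hP'⟩ := hx (c * a)
    refine ⟨P, hP, ?_⟩
    intro θ
    rw [← hP']
    simp only [ContinuousMap.smul_apply, smul_eq_mul, mul_assoc]

lemma aux_approx {w : ℂ → ℝ} (hw : ContinuousOn w (Metric.sphere 0 1)) {ε : ℝ} (hε : 0 < ε) :
    ∃ P : ℂ → ℂ, Differentiable ℂ P ∧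
      ∀ ζ : ℂ, ‖ζ‖ = 1 → |w ζ - (P ζ).re| < ε := by
  have : Fact (0 < 2 * Real.pi) := ⟨by positivity⟩
  have hc : Continuous fun x : AddCircle (2 * Real.pi) => ((w (AddCircle.toCircle x : ℂ) : ℝ) : ℂ) := by
    refine Complex.continuous_ofReal.comp (hw.comp_continuous ?_ ?_)
    · exact continuous_subtype_val.comp AddCircle.continuous_toCircle
    · intro x; exact mem_sphere_zero_iff_norm.2 (Circle.norm_coe _)
  let G : C(AddCircle (2 * Real.pi), ℂ) := ⟨_, hc⟩
  have hG : G ∈ (Submodule.span ℂ (range (@fourier (2 * Real.pi)))).topologicalClosure := by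
    rw [span_fourier_closure_eq_top]; trivial
  have hG' : G ∈ closure ((Submodule.span ℂ (range (@fourier (2 * Real.pi)))) :
    Set C(AddCircle (2 * Real.pi), ℂ)) := hG
  obtain ⟨g, hg, hgd⟩ := Metric.mem_closure_iff.1 hG' ε hε
  obtain ⟨P, hP, hP'⟩ := aux_trig g hg
  refine ⟨P, hP, ?_⟩
  intro ζ hζ
  obtain ⟨θ, rfl⟩ := (Complex.norm_eq_one_iff ζ).1 hζ
  rw [← hP']
  have h1 := (ContinuousMap.dist_apply_le_dist (f := G) (g := g) (θ : AddCircle (2 * Real.pi))).trans_lt hgd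
  rw [Complex.dist_eq] at h1
  have h2 := (Complex.abs_re_le_norm _).trans_lt h1
  have h3 : (G (θ : AddCircle (2 * Real.pi))).re = w (Complex.exp (θ * Complex.I)) := by
    show ((w (AddCircle.toCircle (θ : AddCircle (2 * Real.pi)) : ℂ) : ℝ) : ℂ).re = _
    rw [AddCircle.toCircle_apply_mk, Complex.ofReal_re, Circle.coe_exp]
    have : 2 * Real.pi / (2 * Real.pi) = 1 := by field_simp
    rw [this, one_mul]
  rw [Complex.sub_re, h3] at h2
  exact h2

/-- For continuous functions, comparison implies the sub-mean value inequality. -/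
lemma aux_submean {w : ℂ → ℝ} (hw : ContinuousOn w (Metric.sphere 0 1)) {x : ℝ}
    (h : ∀ g : ℂ → ℂ, Differentiable ℂ g → (∀ ζ : ℂ, ‖ζ‖ = 1 → w ζ ≤ (g ζ).re) → x ≤ (g 0).re) :
    x ≤ (2 * Real.pi)⁻¹ * ∫ θ in (0:ℝ)..(2 * Real.pi), w (Complex.exp (θ * Complex.I)) := by
  refine le_of_forall_pos_le_add fun ε hε => ?_
  obtain ⟨P, hP, hPw⟩ := aux_approx hw (half_pos hε)
  have h1 := h (fun z => P z + (ε / 2 : ℝ)) (by fun_prop) (by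
    intro ζ hζ
    have := (abs_lt.1 (hPw ζ hζ)).2
    simp only [Complex.add_re, Complex.ofReal_re]
    linarith)
  have h2 := aux_mean (fun z => P z - (ε / 2 : ℝ)) (by fun_prop)
  have h3 : ∫ θ in (0:ℝ)..(2 * Real.pi), ((fun z => P z - (ε / 2 : ℝ)) (Complex.exp (θ * Complex.I))).re
      ≤ ∫ θ in (0:ℝ)..(2 * Real.pi), w (Complex.exp (θ * Complex.I)) := by
    refine intervalIntegral.integral_mono_on (by positivity) ?_ ?_ ?_
    · refine Continuous.intervalIntegrable ?_ _ _
      have := hP.continuous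
      fun_prop
    · exact (aux_circ_cont hw).intervalIntegrable _ _
    · intro θ _
      have := (abs_lt.1 (hPw _ (aux_norm_exp θ))).1
      simp only [Complex.sub_re, Complex.ofReal_re]
      linarith
  have h4 := mul_le_mul_of_nonneg_left h3 (by positivity : (0:ℝ) ≤ (2 * Real.pi)⁻¹)
  rw [h2] at h4
  simp only [Complex.add_re, Complex.sub_re, Complex.ofReal_re] at h1 h4
  linarith

lemma aux_coe_max (x y : ℝ) : (max (x : EReal) (y : EReal)).toReal = max x y := by
  rcases le_total x y with h | h
  · rw [max_eq_right (EReal.coe_le_coe_iff.2 h), max_eq_right h, EReal.toReal_coe]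
  · rw [max_eq_left (EReal.coe_le_coe_iff.2 h), max_eq_left h, EReal.toReal_coe]

section
variable {E : Type*} [NormedAddCommGroup E] [NormedSpace ℂ E]

lemma aux_line_cont (a b : E) : Continuous fun ζ : ℂ => a + ζ • b := by fun_prop

lemma SubCmp.pshOn {v : E → ℝ} {D : Set E} (hc : ContinuousOn v D) (h : SubCmp v D) :
    PshOn (fun z => ((v z : ℝ) : EReal)) D := by
  have husc : UpperSemicontinuousOn (fun z => ((v z : ℝ) : EReal)) D :=
    (continuous_coe_real_ereal.comp_continuousOn hc).upperSemicontinuousOn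
  refine ⟨husc, fun z _ => EReal.coe_ne_top _, fun a b => ⟨?_, ?_⟩⟩
  · exact husc.comp (aux_line_cont a b).continuousOn (fun ζ hζ => hζ)
  · intro c r hr hsub m
    rw [EReal.coe_le_coe_iff]
    have hdisc : ∀ ζ : ℂ, ‖ζ‖ ≤ 1 → (a + c • b) + ζ • ((r : ℂ) • b) ∈ D := by
      intro ζ hζ
      have : c + r * ζ ∈ Metric.closedBall c r := by
        rw [mem_closedBall_iff_norm]
        simp only [add_sub_cancel_left, norm_mul, Complex.norm_real, Real.norm_eq_abs,
          abs_of_pos hr]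
        nlinarith
      have h2 := hsub this
      change a + (c + r * ζ) • b ∈ D at h2
      convert h2 using 1
      module
    have hw : ContinuousOn (fun ζ : ℂ => v ((a + c • b) + ζ • ((r : ℂ) • b)))
        (Metric.sphere 0 1) := by
      refine hc.comp (aux_line_cont _ _).continuousOn ?_
      intro ζ hζ
      exact hdisc ζ (mem_sphere_zero_iff_norm.1 hζ).le
    have h1 := aux_submean hw (h (a + c • b) ((r : ℂ) • b) hdisc)
    refine h1.trans ?_
    unfold truncCircleAvg
    refine mul_le_mul_of_nonneg_left ?_ (by positivity)
    have e : ∀ θ : ℝ, v (a + c • b + Complex.exp (θ * Complex.I) • (r : ℂ) • b)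
        = v (a + (c + (r : ℂ) * Complex.exp (θ * Complex.I)) • b) := by
      intro θ
      congr 1
      module
    have hcc := aux_circ_cont hw
    simp only [aux_coe_max]
    simp only [e] at hcc ⊢
    refine intervalIntegral.integral_mono_on (by positivity) ?_ ?_ ?_
    · exact hcc.intervalIntegrable _ _
    · exact (hcc.max continuous_const).intervalIntegrable _ _
    · intro θ _
      exact le_max_left _ _

lemma PshOn.cmp {u : E → EReal} {D : Set E} (h : PshOn u D) (a b : E)
    (hdisc : ∀ ζ : ℂ, ‖ζ‖ ≤ 1 → a + ζ • b ∈ D) (g : ℂ → ℂ) (hg : Differentiable ℂ g)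
    (hle : ∀ ζ : ℂ, ‖ζ‖ = 1 → u (a + ζ • b) ≤ ((g ζ).re : EReal)) :
    u a ≤ ((g 0).re : EReal) := by
  obtain ⟨B, hB⟩ := (isCompact_sphere (0:ℂ) 1).exists_bound_of_continuousOn
    (f := fun z => (g z).re) (by have := hg.continuous; fun_prop)
  obtain ⟨m, hm⟩ := exists_nat_ge B
  have h1 := ((h.2.2 a b).2 0 1 one_pos (by
    intro ζ hζ
    exact hdisc ζ (mem_closedBall_zero_iff.1 hζ))) m
  simp only [zero_smul, add_zero] at h1
  refine h1.trans ?_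
  rw [EReal.coe_le_coe_iff, ← aux_mean g hg]
  unfold truncCircleAvg
  refine mul_le_mul_of_nonneg_left ?_ (by positivity)
  simp only [zero_add, Complex.ofReal_one, one_mul]
  have hbd : ∀ θ : ℝ, -(m : ℝ) ≤ (g (Complex.exp (θ * Complex.I))).re ∧
      (g (Complex.exp (θ * Complex.I))).re ≤ m := by
    intro θ
    have := hB (Complex.exp (θ * Complex.I)) (by simp)
    rw [Real.norm_eq_abs] at this
    exact abs_le.1 (this.trans hm)
  have hle' : ∀ θ : ℝ, max (u (a + Complex.exp (θ * Complex.I) • b)) ((-(m : ℝ) : ℝ) : EReal)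
      ≤ ((g (Complex.exp (θ * Complex.I))).re : EReal) := by
    intro θ
    exact max_le (hle _ (aux_norm_exp θ)) (EReal.coe_le_coe_iff.2 (hbd θ).1)
  have hup : ∀ θ : ℝ, (max (u (a + Complex.exp (θ * Complex.I) • b)) ((-(m : ℝ) : ℝ) : EReal)).toReal
      ≤ (g (Complex.exp (θ * Complex.I))).re := by
    intro θ
    have := EReal.toReal_le_toReal (hle' θ)
      (ne_of_gt (lt_of_lt_of_le (EReal.bot_lt_coe _) (le_max_right _ _))) (EReal.coe_ne_top _)
    simpa using this
  have hlo : ∀ θ : ℝ, -(m : ℝ) ≤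
      (max (u (a + Complex.exp (θ * Complex.I) • b)) ((-(m : ℝ) : ℝ) : EReal)).toReal := by
    intro θ
    have := EReal.toReal_le_toReal
      (le_max_right (u (a + Complex.exp (θ * Complex.I) • b)) ((-(m : ℝ) : ℝ) : EReal))
      (EReal.coe_ne_bot _) (ne_of_lt (lt_of_le_of_lt (hle' θ) (EReal.coe_lt_top _)))
    rwa [EReal.toReal_coe] at this
  have husc : UpperSemicontinuous fun θ : ℝ => u (a + Complex.exp (θ * Complex.I) • b) := by
    rw [← upperSemicontinuousOn_univ_iff]
    exact h.1.comp (g := fun θ : ℝ => a + Complex.exp (θ * Complex.I) • b)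
      (by fun_prop) (fun θ _ => hdisc _ (aux_norm_exp θ).le)
  have hmeas := ((husc.measurable.max
    (measurable_const (a := ((-(m : ℝ) : ℝ) : EReal)))).ereal_toReal)
  refine intervalIntegral.integral_mono_on (by positivity) ?_ ?_ ?_
  · rw [intervalIntegrable_iff]
    refine Measure.integrableOn_of_bounded (M := m) (by rw [uIoc]; exact measure_Ioc_lt_top.ne) hmeas.aestronglyMeasurable ?_
    refine Filter.Eventually.of_forall fun θ => ?_
    rw [Real.norm_eq_abs, abs_le]
    exact ⟨hlo θ, (hup θ).trans (hbd θ).2⟩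
  · refine Continuous.intervalIntegrable ?_ _ _
    have := hg.continuous
    fun_prop
  · intro θ _
    exact hup θ

lemma PshOn.subCmp {v : E → ℝ} {D : Set E} (h : PshOn (fun z => ((v z : ℝ) : EReal)) D) :
    SubCmp v D := by
  intro a b hd g hg hle
  have := h.cmp a b hd g hg (fun ζ hζ => EReal.coe_le_coe_iff.2 (hle ζ hζ))
  exact EReal.coe_le_coe_iff.1 this

lemma SubCmp.sup {v w : E → ℝ} {D : Set E} (h : SubCmp v D) (h' : SubCmp w D) :
    SubCmp (fun z => v z ⊔ w z) D := by
  intro a b hd g hg hle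
  exact max_le (h a b hd g hg fun ζ hζ => (le_max_left _ _).trans (hle ζ hζ))
    (h' a b hd g hg fun ζ hζ => (le_max_right _ _).trans (hle ζ hζ))

lemma SubCmp.mono {v : E → ℝ} {D D' : Set E} (h : SubCmp v D) (hD : D' ⊆ D) : SubCmp v D' :=
  fun a b hd => h a b fun ζ hζ => hD (hd ζ hζ)

lemma SubCmp.congr {v w : E → ℝ} {D : Set E} (h : SubCmp v D) (hw : ∀ z ∈ D, w z = v z) :
    SubCmp w D := by
  intro a b hd g hg hle
  rw [hw a (by simpa using hd 0 (by simp))]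
  refine h a b hd g hg fun ζ hζ => ?_
  rw [← hw _ (hd ζ hζ.le)]
  exact hle ζ hζ

lemma SubCmp.affine {v : E → ℝ} {D : Set E} (h : SubCmp v D) {t : ℝ} (ht : 0 < t) (s : ℝ) :
    SubCmp (fun z => t * v z + s) D := by
  intro a b hd g hg hle
  have := h a b hd (fun z => (t⁻¹ : ℝ) * (g z - s)) (by fun_prop) (by
    intro ζ hζ
    have := hle ζ hζ
    rw [Complex.re_ofReal_mul, Complex.sub_re, Complex.ofReal_re]
    rw [inv_mul_eq_div, le_div_iff₀ ht]
    linarith)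
  rw [Complex.re_ofReal_mul, Complex.sub_re, Complex.ofReal_re, inv_mul_eq_div, le_div_iff₀ ht] at this
  linarith

lemma SubCmp.translate {v : E → ℝ} {D D' : Set E} (h : SubCmp v D) (x : E)
    (hx : ∀ z ∈ D', z + x ∈ D) : SubCmp (fun z => v (z + x)) D' := by
  intro a b hd g hg hle
  refine h (a + x) b (fun ζ hζ => ?_) g hg fun ζ hζ => ?_
  · have := hx _ (hd ζ hζ)
    rwa [add_right_comm]
  · have := hle ζ hζ
    rwa [add_right_comm]

/-- Local comparison implies global comparison. -/
lemma SubCmp.of_local {v : E → ℝ} {U : Set E} (hv : UpperSemicontinuousOn v U)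
    (h : ∀ z ∈ U, ∃ W, IsOpen W ∧ z ∈ W ∧ SubCmp v W) : SubCmp v U := by
  intro a b hd g hg hle
  by_contra hcon
  push Not at hcon
  set ε : ℝ := (v a - (g 0).re) / 2 with hε
  have hεpos : 0 < ε := by rw [hε]; linarith
  let φ : ℂ → ℝ := fun ζ => v (a + ζ • b) + (ε * ‖ζ‖ ^ 2 - (g ζ).re)
  have hφ : UpperSemicontinuousOn φ (Metric.closedBall 0 1) := by
    refine UpperSemicontinuousOn.add ?_ ?_
    · exact hv.comp (aux_line_cont a b).continuousOn
        (fun ζ hζ => hd ζ (mem_closedBall_zero_iff.1 hζ))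
    · refine Continuous.upperSemicontinuous ?_ |>.upperSemicontinuousOn _
      have := hg.continuous
      fun_prop
  obtain ⟨ζ₀, hζ₀, hmax⟩ := hφ.exists_isMaxOn ⟨0, by simp⟩ (isCompact_closedBall 0 1)
  have hmax' : ∀ ζ : ℂ, ‖ζ‖ ≤ 1 → φ ζ ≤ φ ζ₀ := fun ζ hζ => hmax (mem_closedBall_zero_iff.2 hζ)
  have h0 : 2 * ε ≤ φ ζ₀ := by
    refine le_trans (le_of_eq ?_) (hmax' 0 (by simp))
    simp [φ, hε]
    ring
  have hlt : ‖ζ₀‖ < 1 := by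
    refine lt_of_le_of_ne (mem_closedBall_zero_iff.1 hζ₀) fun he => ?_
    have := hle ζ₀ he
    simp only [φ, he] at h0
    linarith
  obtain ⟨W, hWo, hzW, hW⟩ := h (a + ζ₀ • b) (hd ζ₀ hlt.le)
  have hN : {ζ : ℂ | a + ζ • b ∈ W} ∩ Metric.ball 0 1 ∈ 𝓝 ζ₀ :=
    ((hWo.preimage (aux_line_cont a b)).inter Metric.isOpen_ball).mem_nhds
      ⟨hzW, mem_ball_zero_iff.2 hlt⟩
  obtain ⟨s, hs, hsN⟩ := Metric.nhds_basis_closedBall.mem_iff.1 hN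
  have hin : ∀ ξ : ℂ, ‖ξ‖ ≤ 1 → ζ₀ + s * ξ ∈ Metric.closedBall ζ₀ s := by
    intro ξ hξ
    rw [mem_closedBall_iff_norm]
    simp only [add_sub_cancel_left, norm_mul, Complex.norm_real, Real.norm_eq_abs, abs_of_pos hs]
    nlinarith
  have hpt : ∀ ξ : ℂ, (a + ζ₀ • b) + ξ • ((s : ℂ) • b) = a + (ζ₀ + s * ξ) • b := by
    intro ξ; module
  have key := hW (a + ζ₀ • b) ((s : ℂ) • b) (fun ξ hξ => by
      rw [hpt]; exact (hsN (hin ξ hξ)).1)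
    (fun ξ => g (ζ₀ + s * ξ) + (φ ζ₀ - ε * (‖ζ₀‖ ^ 2 + s ^ 2) : ℝ)
      - (2 * ε * s : ℝ) * ((starRingEnd ℂ ζ₀) * ξ)) (by fun_prop) (by
      intro ξ hξ
      rw [hpt]
      have h1 := hmax' _ (mem_ball_zero_iff.1 (hsN (hin ξ hξ.le)).2).le
      have h2 : ‖ζ₀ + s * ξ‖ ^ 2 = ‖ζ₀‖ ^ 2 + s ^ 2 + 2 * s * ((starRingEnd ℂ ζ₀) * ξ).re := by
        have h3 : ‖ξ‖ ^ 2 = 1 := by rw [hξ]; norm_num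
        rw [Complex.sq_norm, Complex.normSq_apply] at h3 ⊢
        rw [Complex.sq_norm, Complex.normSq_apply]
        simp
        linear_combination (s ^ 2) * h3
      simp only [Complex.add_re, Complex.sub_re, Complex.re_ofReal_mul, Complex.ofReal_re]
      have h4 : φ (ζ₀ + s * ξ) = v (a + (ζ₀ + s * ξ) • b) + (ε * ‖ζ₀ + s * ξ‖ ^ 2 - (g (ζ₀ + s * ξ)).re) := rfl
      rw [h4, h2] at h1
      linarith)
  have h5 : φ ζ₀ = v (a + ζ₀ • b) + (ε * ‖ζ₀‖ ^ 2 - (g ζ₀).re) := rfl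
  simp at key
  have : 0 < ε * s ^ 2 := by positivity
  simp only [← Complex.ofReal_pow, Complex.ofReal_re] at key
  linarith

end

section
variable {E : Type*} [NormedAddCommGroup E] [InnerProductSpace ℂ E]

lemma aux_norm_sq (a b : E) (ζ : ℂ) (hζ : ‖ζ‖ = 1) :
    ‖a + ζ • b‖ ^ 2 = ‖a‖ ^ 2 + ‖b‖ ^ 2 + 2 * (inner ℂ a b * ζ).re := by
  rw [norm_add_sq (𝕜 := ℂ), inner_smul_right, norm_smul, hζ, one_mul, mul_comm ζ]
  simp only [RCLike.re_to_complex]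
  ring

lemma SubCmp.add_quad {F G : E → ℝ} {D : Set E} (hF : ContinuousOn F D) (hG : ContinuousOn G D)
    (hF' : SubCmp F D) (hG' : SubCmp G D) {k : ℝ} (hk : 0 ≤ k) (s : ℝ) :
    SubCmp (fun z => F z + k * (G z + ‖z‖ ^ 2) + s) D := by
  intro a b hd g hg hle
  have hmap : MapsTo (fun ζ : ℂ => a + ζ • b) (Metric.sphere 0 1) D := fun ζ hζ =>
    hd ζ (mem_sphere_zero_iff_norm.1 hζ).le
  have hFc : ContinuousOn (fun ζ : ℂ => F (a + ζ • b)) (Metric.sphere 0 1) :=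
    hF.comp (aux_line_cont a b).continuousOn hmap
  have hGc : ContinuousOn (fun ζ : ℂ => G (a + ζ • b)) (Metric.sphere 0 1) :=
    hG.comp (aux_line_cont a b).continuousOn hmap
  have h1 := aux_submean hFc (hF' a b hd)
  have h2 := aux_submean hGc (hG' a b hd)
  have h3 := aux_mean (fun ζ => g ζ - (k * (‖a‖ ^ 2 + ‖b‖ ^ 2) + s : ℝ)
    - (2 * k : ℝ) * (inner ℂ a b * ζ)) (by fun_prop)
  have i1 := (aux_circ_cont hFc).intervalIntegrable (μ := volume) 0 (2 * Real.pi)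
  have i2 := (aux_circ_cont hGc).intervalIntegrable (μ := volume) 0 (2 * Real.pi)
  have h4 : (∫ θ in (0:ℝ)..(2 * Real.pi), (F (a + Complex.exp (θ * Complex.I) • b)
      + k * G (a + Complex.exp (θ * Complex.I) • b))) ≤
      ∫ θ in (0:ℝ)..(2 * Real.pi), ((fun ζ => g ζ - (k * (‖a‖ ^ 2 + ‖b‖ ^ 2) + s : ℝ)
    - (2 * k : ℝ) * (inner ℂ a b * ζ)) (Complex.exp (θ * Complex.I))).re := by
    refine intervalIntegral.integral_mono_on (by positivity) (i1.add (i2.const_mul k)) ?_ ?_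
    · refine Continuous.intervalIntegrable ?_ _ _
      have := hg.continuous
      fun_prop
    · intro θ _
      have h5 := hle _ (aux_norm_exp θ)
      have h6 := aux_norm_sq a b _ (aux_norm_exp θ)
      simp only [Complex.sub_re, Complex.re_ofReal_mul, Complex.ofReal_re]
      beta_reduce at h5
      rw [h6] at h5
      linarith
  rw [intervalIntegral.integral_add i1 (i2.const_mul k), intervalIntegral.integral_const_mul] at h4
  have h7 := mul_le_mul_of_nonneg_left h4 (by positivity : (0:ℝ) ≤ (2 * Real.pi)⁻¹)
  rw [h3] at h7
  simp only [mul_zero, sub_zero, Complex.sub_re, Complex.ofReal_re] at h7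
  have h8 := mul_le_mul_of_nonneg_left h2 hk
  have h9 : 0 ≤ k * ‖b‖ ^ 2 := by positivity
  linarith

lemma aux_rho [ProperSpace E] [Nontrivial E] {D : Set E} (hDo : IsOpen D)
    (hDb : Bornology.IsBounded D) {G : E → ℝ} (hG : ContinuousOn G (closure D))
    (hG' : SubCmp G D) (hGf : ∀ x ∈ frontier D, G x = -‖x‖ ^ 2) :
    ∀ z ∈ D, G z + ‖z‖ ^ 2 < 0 := by
  intro z₁ hz₁
  by_contra hcon
  push Not at hcon
  have hc : ContinuousOn (fun z => G z + ‖z‖ ^ 2) (closure D) := hG.add (by fun_prop)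
  obtain ⟨z₂, hz₂, hmax⟩ := hDb.isCompact_closure.exists_isMaxOn ⟨z₁, subset_closure hz₁⟩ hc
  have hmax' : ∀ z ∈ closure D, G z + ‖z‖ ^ 2 ≤ G z₂ + ‖z₂‖ ^ 2 := fun z hz => hmax hz
  obtain ⟨z₀, hz₀, h0⟩ : ∃ z₀ ∈ D, ∀ z ∈ closure D, G z + ‖z‖ ^ 2 ≤ G z₀ + ‖z₀‖ ^ 2 := by
    by_cases h : z₂ ∈ D
    · exact ⟨z₂, h, hmax'⟩
    · refine ⟨z₁, hz₁, fun z hz => (hmax' z hz).trans ?_⟩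
      have : z₂ ∈ frontier D := by
        rw [hDo.frontier_eq]; exact ⟨hz₂, h⟩
      rw [hGf z₂ this]
      linarith
  obtain ⟨s, hs, hsD⟩ := Metric.nhds_basis_closedBall.mem_iff.1 (hDo.mem_nhds hz₀)
  obtain ⟨e, he⟩ := exists_norm_eq E hs.le
  have hd : ∀ ζ : ℂ, ‖ζ‖ ≤ 1 → z₀ + ζ • e ∈ D := by
    intro ζ hζ
    apply hsD
    rw [mem_closedBall_iff_norm, add_sub_cancel_left, norm_smul, he]
    nlinarith
  have := hG' z₀ e hd (fun ζ => (G z₀ - ‖e‖ ^ 2 : ℝ) - (2 : ℝ) * (inner ℂ z₀ e * ζ))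
    (by fun_prop) (by
      intro ζ hζ
      have h1 := h0 _ (subset_closure (hd ζ hζ.le))
      rw [aux_norm_sq _ _ _ hζ] at h1
      simp only [Complex.sub_re, Complex.re_ofReal_mul, Complex.ofReal_re]
      linarith)
  simp only [mul_zero, sub_zero, Complex.ofReal_re, he] at this
  have : 0 < s ^ 2 := by positivity
  linarith

lemma aux_barrier [ProperSpace E] [Nontrivial E] {D : Set E} (hDo : IsOpen D)
    (hDb : Bornology.IsBounded D) (hreg : BRegular D) {f : E → ℝ} (hf : Continuous f)
    {ε : ℝ} (hε : 0 < ε) :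
    ∃ b : E → ℝ, ContinuousOn b (closure D) ∧ SubCmp b D ∧ (∀ z ∈ closure D, b z ≤ f z) ∧
      ∀ x ∈ frontier D, b x = f x - ε := by
  obtain ⟨F, hF, hF', hFf⟩ := hreg f hf.continuousOn
  obtain ⟨G, hG, hG', hGf⟩ := hreg (fun z => -‖z‖ ^ 2) (by fun_prop)
  have hrho := aux_rho hDo hDb hG hG'.subCmp hGf
  have hrho' : ∀ z ∈ closure D, G z + ‖z‖ ^ 2 ≤ 0 := by
    intro z hz
    by_cases h : z ∈ D
    · exact (hrho z h).le
    · rw [hGf z (by rw [hDo.frontier_eq]; exact ⟨hz, h⟩)]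
      linarith
  have hcF : ContinuousOn (fun z => F z - f z) (closure D) := hF.sub hf.continuousOn
  have hcG : ContinuousOn (fun z => G z + ‖z‖ ^ 2) (closure D) := hG.add (by fun_prop)
  obtain ⟨k, hk, hkle⟩ : ∃ k : ℝ, 0 ≤ k ∧ ∀ z ∈ closure D, ε ≤ F z - f z →
      F z - f z + k * (G z + ‖z‖ ^ 2) ≤ 0 := by
    have hL : IsCompact (closure D ∩ (fun z => F z - f z) ⁻¹' Ici ε) :=
      hDb.isCompact_closure.of_isClosed_subset
        (hcF.preimage_isClosed_of_isClosed isClosed_closure isClosed_Ici) inter_subset_left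
    rcases (closure D ∩ (fun z => F z - f z) ⁻¹' Ici ε).eq_empty_or_nonempty with he | hne
    · refine ⟨0, le_rfl, fun z hz hz' => ?_⟩
      have : z ∈ closure D ∩ (fun z => F z - f z) ⁻¹' Ici ε := ⟨hz, hz'⟩
      rw [he] at this
      exact this.elim
    · obtain ⟨p, hp, hpmax⟩ := hL.exists_isMaxOn hne (hcG.mono inter_subset_left)
      obtain ⟨q, hq, hqmax⟩ := hL.exists_isMaxOn hne (hcF.mono inter_subset_left)
      have hpD : p ∈ D := by
        by_contra h
        have h1 := hFf p (by rw [hDo.frontier_eq]; exact ⟨hp.1, h⟩)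
        have h2 : ε ≤ F p - f p := hp.2
        linarith
      have hp0 := hrho p hpD
      have hq0 : ε ≤ F q - f q := hq.2
      refine ⟨(F q - f q) / (-(G p + ‖p‖ ^ 2)), div_nonneg (by linarith) (by linarith), ?_⟩
      intro z hz hz'
      have h1 : F z - f z ≤ F q - f q := hqmax (show z ∈ _ ∩ _ from ⟨hz, hz'⟩)
      have h2 : G z + ‖z‖ ^ 2 ≤ G p + ‖p‖ ^ 2 := hpmax (show z ∈ _ ∩ _ from ⟨hz, hz'⟩)
      have h3 := mul_le_mul_of_nonneg_left h2 (div_nonneg (by linarith) (by linarith) :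
        0 ≤ (F q - f q) / (-(G p + ‖p‖ ^ 2)))
      have h4 : (F q - f q) / (-(G p + ‖p‖ ^ 2)) * (G p + ‖p‖ ^ 2) = -(F q - f q) := by
        have : G p + ‖p‖ ^ 2 ≠ 0 := hp0.ne
        field_simp
      linarith
  refine ⟨fun z => F z + k * (G z + ‖z‖ ^ 2) + (-ε), ?_, ?_, ?_, ?_⟩
  · exact (hF.add (continuousOn_const.mul hcG)).add continuousOn_const
  · exact SubCmp.add_quad (hF.mono subset_closure) (hG.mono subset_closure) hF'.subCmp
      hG'.subCmp hk _
  · intro z hz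
    have h1 := mul_nonpos_of_nonneg_of_nonpos hk (hrho' z hz)
    by_cases h : ε ≤ F z - f z
    · have := hkle z hz h
      linarith
    · linarith
  · intro x hx
    simp only [hFf x hx, hGf x hx]
    ring

lemma aux_usc_local {w : E → ℝ} {D : Set E}
    (h : ∀ z ∈ D, ∃ W, IsOpen W ∧ z ∈ W ∧ ∃ v : E → ℝ, UpperSemicontinuousOn v W ∧
      ∀ y ∈ W, w y = v y) : UpperSemicontinuousOn w D := by
  intro z hz y hy
  obtain ⟨W, hWo, hzW, v, hv, hwv⟩ := h z hz
  rw [hwv z hzW] at hy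
  have h1 := hv z hzW y hy
  rw [hWo.nhdsWithin_eq hzW] at h1
  refine mem_nhdsWithin_of_mem_nhds ?_
  filter_upwards [h1, hWo.mem_nhds hzW] with x hx hxW
  rw [hwv x hxW]
  exact hx

/-- The Perron family below `f`. -/
def PFam (f : E → ℝ) (D : Set E) : Set (E → ℝ) :=
  {v | UpperSemicontinuousOn v D ∧ SubCmp v D ∧ ∀ z ∈ D, v z ≤ f z}

lemma aux_shift [ProperSpace E] [Nontrivial E] {D : Set E} (hDo : IsOpen D)
    (hDb : Bornology.IsBounded D) (hreg : BRegular D) {f : E → ℝ} (hf : Continuous f)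
    {ε : ℝ} (hε : 0 < ε) :
    ∃ η > 0, ∀ δ, 0 < δ → δ < η → ∀ h : E, ‖h‖ < δ → ∀ v ∈ PFam f D, ∃ w ∈ PFam f D,
      ∀ z ∈ D, δ < Metric.infDist z Dᶜ → v (z + h) ≤ w z + 4 * ε := by
  obtain ⟨b, hb, hb', hbf, hbx⟩ := aux_barrier hDo hDb hreg hf hε
  have hDc : (Dᶜ : Set E).Nonempty := by
    rw [nonempty_compl]
    rintro rfl
    exact NormedSpace.unbounded_univ ℂ E hDb
  have hclD : IsClosed (Dᶜ : Set E) := hDo.isClosed_compl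
  obtain ⟨η₁, hη₁, hN⟩ : ∃ η₁ > 0, ∀ z ∈ D, Metric.infDist z Dᶜ < η₁ → f z - 2 * ε < b z := by
    have hcb : ContinuousOn (fun z => f z - b z) (closure D) := hf.continuousOn.sub hb
    have hL : IsCompact (closure D ∩ (fun z => f z - b z) ⁻¹' Ici (2 * ε)) :=
      hDb.isCompact_closure.of_isClosed_subset
        (hcb.preimage_isClosed_of_isClosed isClosed_closure isClosed_Ici) inter_subset_left
    rcases (closure D ∩ (fun z => f z - b z) ⁻¹' Ici (2 * ε)).eq_empty_or_nonempty with he | hne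
    · refine ⟨1, one_pos, fun z hz _ => ?_⟩
      by_contra hcon
      have : z ∈ closure D ∩ (fun z => f z - b z) ⁻¹' Ici (2 * ε) :=
        ⟨subset_closure hz, show 2 * ε ≤ f z - b z by linarith⟩
      rw [he] at this
      exact this.elim
    · obtain ⟨p, hp, hpmin⟩ := hL.exists_isMinOn hne
        (Metric.continuous_infDist_pt (Dᶜ : Set E)).continuousOn
      have hpD : p ∈ D := by
        by_contra h
        have h1 := hbx p (by rw [hDo.frontier_eq]; exact ⟨hp.1, h⟩)
        have h2 : 2 * ε ≤ f p - b p := hp.2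
        linarith
      refine ⟨Metric.infDist p Dᶜ, ?_, fun z hz hz' => ?_⟩
      · exact (hclD.notMem_iff_infDist_pos hDc).1 (fun h => h hpD)
      · by_contra hcon
        have : Metric.infDist p Dᶜ ≤ Metric.infDist z Dᶜ :=
          hpmin (show z ∈ _ ∩ _ from ⟨subset_closure hz, show 2 * ε ≤ f z - b z by linarith⟩)
        linarith
  obtain ⟨η₂, hη₂, hfu⟩ := Metric.uniformContinuousOn_iff.1
    (hDb.isCompact_closure.uniformContinuousOn_of_continuous hf.continuousOn) ε hε
  refine ⟨min η₁ η₂, lt_min hη₁ hη₂, ?_⟩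
  intro δ hδ hδη h hh v hv
  obtain ⟨hv1, hv2, hv3⟩ := hv
  have hin : ∀ z, δ < Metric.infDist z Dᶜ → z + h ∈ D := by
    intro z hz
    by_contra hcon
    have h1 := Metric.infDist_le_dist_of_mem (x := z) (show z + h ∈ Dᶜ from hcon)
    rw [dist_self_add_right] at h1
    linarith
  have hsh : ∀ z ∈ D, δ < Metric.infDist z Dᶜ → v (z + h) - 4 * ε ≤ f z - 3 * ε := by
    intro z hz hz'
    have h1 := hv3 _ (hin z hz')
    have h2 := hfu (z + h) (subset_closure (hin z hz')) z (subset_closure hz) (by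
      rw [dist_self_add_left]
      exact hh.trans (hδη.trans_le (min_le_right _ _)))
    rw [Real.dist_eq] at h2
    have := (abs_lt.1 h2).2
    linarith
  classical
  let v' : E → ℝ := fun z => v z ⊔ b z
  have hv'1 : UpperSemicontinuousOn v' D :=
    hv1.sup (hb.mono subset_closure).upperSemicontinuousOn
  have hv'2 : SubCmp v' D := hv2.sup hb'
  have hv'3 : ∀ z ∈ D, v' z ≤ f z := fun z hz => max_le (hv3 z hz) (hbf z (subset_closure hz))
  let q : E → ℝ := fun z => 1 * v (z + h) + (-(4 * ε))
  let w : E → ℝ := fun z => if δ < Metric.infDist z Dᶜ then v' z ⊔ q z else v' z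
  have hU1o : IsOpen (D ∩ {z | δ < Metric.infDist z Dᶜ}) :=
    hDo.inter (isOpen_lt continuous_const (Metric.continuous_infDist_pt _))
  have hU2o : IsOpen (D ∩ {z | Metric.infDist z Dᶜ < η₁}) :=
    hDo.inter (isOpen_lt (Metric.continuous_infDist_pt _) continuous_const)
  have hU1 : ∀ z ∈ D ∩ {z | δ < Metric.infDist z Dᶜ}, w z = v' z ⊔ q z := fun z hz => if_pos hz.2
  have hU2 : ∀ z ∈ D ∩ {z | Metric.infDist z Dᶜ < η₁}, w z = v' z := by
    intro z hz
    by_cases hz' : δ < Metric.infDist z Dᶜ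
    · rw [hU1 z ⟨hz.1, hz'⟩]
      refine sup_eq_left.2 ?_
      have h1 := hsh z hz.1 hz'
      have h2 := hN z hz.1 hz.2
      have h3 : b z ≤ v' z := le_max_right _ _
      simp only [q]
      linarith
    · exact if_neg hz'
  have hcover : ∀ z ∈ D, z ∈ D ∩ {z | δ < Metric.infDist z Dᶜ} ∨
      z ∈ D ∩ {z | Metric.infDist z Dᶜ < η₁} := by
    intro z hz
    rcases lt_or_ge δ (Metric.infDist z Dᶜ) with h1 | h1
    · exact Or.inl ⟨hz, h1⟩
    · exact Or.inr ⟨hz, h1.trans_lt (hδη.trans_le (min_le_left _ _))⟩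
  have husc1 : UpperSemicontinuousOn (fun z => v' z ⊔ q z) (D ∩ {z | δ < Metric.infDist z Dᶜ}) := by
    refine (hv'1.mono inter_subset_left).sup ?_
    refine UpperSemicontinuousOn.add ?_ upperSemicontinuousOn_const
    simp only [one_mul]
    exact hv1.comp (g := fun z => z + h) (by fun_prop) (fun z hz => hin z hz.2)
  have hsub1 : SubCmp (fun z => v' z ⊔ q z) (D ∩ {z | δ < Metric.infDist z Dᶜ}) := by
    refine (hv'2.mono inter_subset_left).sup ?_
    exact (hv2.translate h (fun z hz => hin z hz.2)).affine one_pos _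
  have hw1 : UpperSemicontinuousOn w D := by
    refine aux_usc_local fun z hz => ?_
    rcases hcover z hz with h1 | h1
    · exact ⟨_, hU1o, h1, _, husc1, hU1⟩
    · exact ⟨_, hU2o, h1, _, hv'1.mono inter_subset_left, hU2⟩
  refine ⟨w, ⟨hw1, ?_, ?_⟩, ?_⟩
  · refine SubCmp.of_local hw1 fun z hz => ?_
    rcases hcover z hz with h1 | h1
    · exact ⟨_, hU1o, h1, hsub1.congr hU1⟩
    · exact ⟨_, hU2o, h1, (hv'2.mono inter_subset_left).congr hU2⟩
  · intro z hz
    by_cases hz' : δ < Metric.infDist z Dᶜ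
    · rw [hU1 z ⟨hz, hz'⟩]
      refine max_le (hv'3 z hz) ?_
      have := hsh z hz hz'
      simp only [q]
      linarith
    · have : w z = v' z := if_neg hz'
      rw [this]
      exact hv'3 z hz
  · intro z hz hz'
    rw [hU1 z ⟨hz, hz'⟩]
    have : q z ≤ v' z ⊔ q z := le_max_right _ _
    simp only [q] at this ⊢
    linarith

/-- Envelopes are continuous (Walsh). -/
lemma aux_walsh [ProperSpace E] [Nontrivial E] {D : Set E} (hDo : IsOpen D)
    (hDb : Bornology.IsBounded D) (hreg : BRegular D) {f : E → ℝ} (hf : Continuous f)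
    {u : E → EReal} (hu : PshOn u D) (huf : ∀ z ∈ D, u z ≤ (f z : EReal)) :
    ∃ ψ : E → ℝ, ContinuousOn ψ (closure D) ∧ SubCmp ψ D ∧ (∀ z ∈ closure D, ψ z ≤ f z) ∧
      ∀ z ∈ D, u z ≤ (ψ z : EReal) := by
  classical
  let S : E → ℝ := fun z => sSup ((fun v : E → ℝ => v z) '' PFam f D)
  have hbarrier : ∀ ε > 0, ∃ b ∈ PFam f D, ContinuousOn b (closure D) ∧
      (∀ z ∈ closure D, b z ≤ f z) ∧ ∀ x ∈ frontier D, b x = f x - ε := by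
    intro ε hε
    obtain ⟨b, hb, hb', hbf, hbx⟩ := aux_barrier hDo hDb hreg hf hε
    exact ⟨b, ⟨(hb.mono subset_closure).upperSemicontinuousOn, hb',
      fun z hz => hbf z (subset_closure hz)⟩, hb, hbf, hbx⟩
  obtain ⟨b₁, hb₁, hb₁c, -⟩ := hbarrier 1 one_pos
  have hne : (PFam f D).Nonempty := ⟨b₁, hb₁⟩
  have hle : ∀ z ∈ D, ∀ v ∈ PFam f D, v z ≤ S z := by
    intro z hz v hv
    refine le_csSup ⟨f z, ?_⟩ ⟨v, hv, rfl⟩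
    rintro _ ⟨v, hv, rfl⟩
    exact hv.2.2 z hz
  have hub : ∀ z c, (∀ v ∈ PFam f D, v z ≤ c) → S z ≤ c := by
    intro z c h
    refine csSup_le (hne.image _) ?_
    rintro _ ⟨v, hv, rfl⟩
    exact h v hv
  have hSf : ∀ z ∈ D, S z ≤ f z := fun z hz => hub z _ fun v hv => hv.2.2 z hz
  have hSsub : SubCmp S D := by
    intro a b hd g hg hle'
    refine hub a _ fun v hv => hv.2.1 a b hd g hg fun ζ hζ => ?_
    exact (hle _ (hd ζ hζ.le) v hv).trans (hle' ζ hζ)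
  have hDc : (Dᶜ : Set E).Nonempty := by
    rw [nonempty_compl]
    rintro rfl
    exact NormedSpace.unbounded_univ ℂ E hDb
  have hclD : IsClosed (Dᶜ : Set E) := hDo.isClosed_compl
  have hScont : ∀ z ∈ D, ContinuousAt S z := by
    intro z₀ hz₀
    rw [Metric.continuousAt_iff]
    intro ε hε
    obtain ⟨η, hη, hsh⟩ := aux_shift hDo hDb hreg hf (show 0 < ε / 8 by positivity)
    have hd : 0 < Metric.infDist z₀ Dᶜ :=
      (hclD.notMem_iff_infDist_pos hDc).1 (fun h => h hz₀)
    set δ : ℝ := min η (Metric.infDist z₀ Dᶜ) / 3 with hδ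
    have hmin : 0 < min η (Metric.infDist z₀ Dᶜ) := lt_min hη hd
    have hm1 := min_le_left η (Metric.infDist z₀ Dᶜ)
    have hm2 := min_le_right η (Metric.infDist z₀ Dᶜ)
    have hδ0 : 0 < δ := by rw [hδ]; positivity
    have hδη : δ < η := by rw [hδ]; linarith
    have hδd : 3 * δ ≤ Metric.infDist z₀ Dᶜ := by rw [hδ]; linarith
    have key : ∀ z ∈ D, δ < Metric.infDist z Dᶜ → ∀ y, dist y z < δ →
        S y ≤ S z + 4 * (ε / 8) := by
      intro z hz hzd y hy
      refine hub y _ fun v hv => ?_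
      rw [dist_eq_norm] at hy
      obtain ⟨w, hw, hw'⟩ := hsh δ hδ0 hδη (y - z) hy v hv
      have h1 := hw' z hz hzd
      rw [add_sub_cancel] at h1
      have h2 := hle z hz w hw
      linarith
    refine ⟨δ, hδ0, fun {y} hy => ?_⟩
    have h1 := key z₀ hz₀ (by linarith) y hy
    have h2 : Metric.infDist z₀ Dᶜ ≤ Metric.infDist y Dᶜ + dist z₀ y :=
      Metric.infDist_le_infDist_add_dist
    rw [dist_comm] at h2
    have hyd : δ < Metric.infDist y Dᶜ := by linarith
    have hyD : y ∈ D := by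
      by_contra hcon
      rw [Metric.infDist_zero_of_mem (show y ∈ Dᶜ from hcon)] at hyd
      linarith
    have h3 := key y hyD hyd z₀ (by rwa [dist_comm])
    rw [Real.dist_eq, abs_lt]
    constructor <;> linarith
  let ψ : E → ℝ := fun z => if z ∈ D then S z else f z
  have hψS : ∀ z ∈ D, ψ z = S z := fun z hz => if_pos hz
  have hψf : ∀ z, z ∉ D → ψ z = f z := fun z hz => if_neg hz
  have hψle : ∀ z ∈ closure D, ψ z ≤ f z := by
    intro z hz
    by_cases h : z ∈ D
    · rw [hψS z h]; exact hSf z h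
    · rw [hψf z h]
  refine ⟨ψ, ?_, hSsub.congr hψS, hψle, ?_⟩
  · intro x hx
    by_cases hxD : x ∈ D
    · have : ContinuousAt ψ x := (hScont x hxD).congr (by
        filter_upwards [hDo.mem_nhds hxD] with y hy
        rw [hψS y hy])
      exact this.continuousWithinAt
    · have hxf : x ∈ frontier D := by rw [hDo.frontier_eq]; exact ⟨hx, hxD⟩
      refine Metric.tendsto_nhds.2 fun ε hε => ?_
      obtain ⟨b, hb, hbc, hbf, hbx⟩ := hbarrier (ε / 2) (half_pos hε)
      have h1 : ∀ᶠ y in 𝓝[closure D] x, dist (b y) (b x) < ε / 2 :=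
        Metric.tendsto_nhds.1 (hbc x hx) _ (half_pos hε)
      have h2 : ∀ᶠ y in 𝓝[closure D] x, dist (f y) (f x) < ε :=
        Metric.tendsto_nhds.1 (hf.continuousWithinAt (s := closure D) (x := x)) _ hε
      filter_upwards [h1, h2, self_mem_nhdsWithin] with y hy1 hy2 hy
      have hby : b y ≤ ψ y := by
        by_cases h : y ∈ D
        · rw [hψS y h]; exact hle y h b hb
        · rw [hψf y h]; exact hbf y hy
      have hfy := hψle y hy
      rw [hψf x hxD]
      rw [Real.dist_eq, abs_lt] at hy1 hy2 ⊢
      rw [hbx x hxf] at hy1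
      constructor <;> linarith [hy1.1, hy2.2]
  · intro z hz
    have hco : ∀ y ∈ D, (((max (u y) (b₁ y : EReal)).toReal : ℝ) : EReal)
        = max (u y) (b₁ y : EReal) := by
      intro y hy
      refine EReal.coe_toReal ?_ ?_
      · exact ne_of_lt (max_lt (lt_top_iff_ne_top.2 (hu.2.1 y hy)) (EReal.coe_lt_top _))
      · exact ne_of_gt (lt_of_lt_of_le (EReal.bot_lt_coe _) (le_max_right _ _))
    have hv : (fun y => (max (u y) (b₁ y : EReal)).toReal) ∈ PFam f D := by
      refine ⟨?_, ?_, ?_⟩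
      · intro y hy t ht
        have husc : UpperSemicontinuousOn (fun y => u y ⊔ (b₁ y : EReal)) D :=
          hu.1.sup (continuous_coe_real_ereal.comp_continuousOn
            (hb₁c.mono subset_closure)).upperSemicontinuousOn
        have h1 := husc y hy (t : EReal) (by
          have := EReal.coe_lt_coe_iff.2 ht
          rwa [hco y hy] at this)
        filter_upwards [h1, self_mem_nhdsWithin] with x hx hxD
        rw [← EReal.coe_lt_coe_iff, hco x hxD]
        exact hx
      · intro a b hd g hg hle'
        have haD : a ∈ D := by simpa using hd 0 (by simp)
        rw [← EReal.coe_le_coe_iff, hco a haD]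
        have hle2 : ∀ ζ : ℂ, ‖ζ‖ = 1 → max (u (a + ζ • b)) (b₁ (a + ζ • b) : EReal)
            ≤ ((g ζ).re : EReal) := by
          intro ζ hζ
          rw [← hco _ (hd ζ hζ.le), EReal.coe_le_coe_iff]
          exact hle' ζ hζ
        refine max_le ?_ ?_
        · exact hu.cmp a b hd g hg fun ζ hζ => (le_max_left _ _).trans (hle2 ζ hζ)
        · rw [EReal.coe_le_coe_iff]
          refine hb₁.2.1 a b hd g hg fun ζ hζ => ?_
          rw [← EReal.coe_le_coe_iff]
          exact (le_max_right _ _).trans (hle2 ζ hζ)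
      · intro y hy
        rw [← EReal.coe_le_coe_iff, hco y hy]
        exact max_le (huf y hy) (EReal.coe_le_coe_iff.2 (hb₁.2.2 y hy))
    rw [hψS z hz]
    have h1 := EReal.coe_le_coe_iff.2 (hle z hz _ hv)
    rw [hco z hz] at h1
    exact (le_max_left _ _).trans h1

end
/-- Let `D` be B-regular, `A ⊆ ∂D` b-pluripolar, `F, K ⊆ cl(D)`
compact with `F ⊆ Â` and `K ⊆ cl(D) \ Â`.  Then for every `C > 0` there is
`ψ ∈ PSH(D) ∩ C(cl(D))` with `ψ < 0` on `cl(D)`, `ψ < -C` on `F` and `ψ > -1` on `K`. -/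
theorem exists_continuous_psh_separating {n : ℕ}
    (D A F K : Set (EuclideanSpace ℂ (Fin n))) (hD : IsBddDomain D)
    (hreg : BRegular D) (hA : A ⊆ frontier D) (hbp : BPluripolar A D)
    (hF : IsCompact F) (hFsub : F ⊆ bHull A D)
    (hK : IsCompact K) (hKsub : K ⊆ closure D \ bHull A D) :
    ∀ C : ℝ, 0 < C →
      ∃ ψ : EuclideanSpace ℂ (Fin n) → ℝ,
        ContinuousOn ψ (closure D) ∧ PshOn (fun z => ((ψ z : ℝ) : EReal)) D ∧
        (∀ z ∈ closure D, ψ z < 0) ∧ (∀ z ∈ F, ψ z < -C) ∧ (∀ z ∈ K, -1 < ψ z) := by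
  intro C hC
  have hbase : ∀ c : ℝ, SubCmp (fun _ : EuclideanSpace ℂ (Fin n) => c) D := by
    intro c a b hd g hg hle
    rw [← aux_mean g hg]
    have h1 : ∫ θ in (0:ℝ)..(2 * Real.pi), c ≤
        ∫ θ in (0:ℝ)..(2 * Real.pi), (g (Complex.exp (θ * Complex.I))).re := by
      refine intervalIntegral.integral_mono_on (by positivity) (by simp) ?_ ?_
      · refine Continuous.intervalIntegrable ?_ _ _
        have := hg.continuous
        fun_prop
      · intro θ _
        exact hle _ (aux_norm_exp θ)
    have h2 := mul_le_mul_of_nonneg_left h1 (by positivity : (0:ℝ) ≤ (2 * Real.pi)⁻¹)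
    refine le_trans (le_of_eq ?_) h2
    rw [intervalIntegral.integral_const, smul_eq_mul, sub_zero]
    have := Real.pi_ne_zero
    field_simp
  -- suffices to find such functions in the comparison class
  suffices H : ∃ ψ : EuclideanSpace ℂ (Fin n) → ℝ,
      ContinuousOn ψ (closure D) ∧ SubCmp ψ D ∧
        (∀ z ∈ closure D, ψ z < 0) ∧ (∀ z ∈ F, ψ z < -C) ∧ (∀ z ∈ K, -1 < ψ z) by
    obtain ⟨ψ, h1, h2, h3⟩ := H
    exact ⟨ψ, h1, h2.pshOn (h1.mono subset_closure), h3⟩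
  have hDo := hD.1
  have hDb := hD.2.2
  refine hK.induction_on (p := fun s => ∃ ψ : EuclideanSpace ℂ (Fin n) → ℝ,
      ContinuousOn ψ (closure D) ∧ SubCmp ψ D ∧
        (∀ z ∈ closure D, ψ z < 0) ∧ (∀ z ∈ F, ψ z < -C) ∧ (∀ z ∈ s, -1 < ψ z)) ?_ ?_ ?_ ?_
  · refine ⟨fun _ => -C - 1, continuousOn_const, hbase _, ?_, ?_, ?_⟩
    · intro z _; linarith
    · intro z _; linarith
    · intro z hz; exact hz.elim
  · rintro s t hst ⟨ψ, h1, h2, h3, h4, h5⟩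
    exact ⟨ψ, h1, h2, h3, h4, fun z hz => h5 z (hst hz)⟩
  · rintro s t ⟨ψ, h1, h2, h3, h4, h5⟩ ⟨φ, k1, k2, k3, k4, k5⟩
    refine ⟨fun z => ψ z ⊔ φ z, h1.sup k1, h2.sup k2, fun z hz => max_lt (h3 z hz) (k3 z hz),
      fun z hz => max_lt (h4 z hz) (k4 z hz), ?_⟩
    rintro z (hz | hz)
    · exact lt_max_of_lt_left (h5 z hz)
    · exact lt_max_of_lt_right (k5 z hz)
  · intro x hx
    obtain ⟨hxD, hxA⟩ := hKsub hx
    obtain ⟨u, hu, hu0, hune, huA, hux⟩ : ∃ u : EuclideanSpace ℂ (Fin n) → EReal, PshOn u D ∧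
        (∀ y ∈ D, u y < 0) ∧ (∃ y ∈ D, u y ≠ ⊥) ∧ (∀ x ∈ A, uscReg u D x = ⊥) ∧
        uscReg u D x ≠ ⊥ := by
      by_contra hcon
      refine hxA ⟨hxD, fun u h1 h2 h3 h4 => ?_⟩
      by_contra h5
      exact hcon ⟨u, h1, h2, h3, h4, h5⟩
    have huF : ∀ y ∈ F, uscReg u D y = ⊥ := fun y hy => (hFsub hy).2 u hu hu0 hune huA
    rcases subsingleton_or_nontrivial (EuclideanSpace ℂ (Fin n)) with hs | hs
    · refine ⟨K, self_mem_nhdsWithin, fun _ => -1 / 2, continuousOn_const, hbase _, ?_, ?_, ?_⟩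
      · intro z _; norm_num
      · intro z hz
        exact absurd (huF z hz) (by rwa [Subsingleton.elim z x])
      · intro z _; norm_num
    -- choose a real lower bound `-B` for `u*(x)`
    obtain ⟨B, hB, hBx⟩ : ∃ B : ℝ, 0 < B ∧ ((-B : ℝ) : EReal) < uscReg u D x := by
      obtain ⟨t, ht, -⟩ | ht : (∃ t : ℝ, ((t : ℝ) : EReal) < uscReg u D x ∧ True) ∨ False := by
        left
        obtain ⟨t, _, ht⟩ := EReal.lt_iff_exists_real_btwn.1 (bot_lt_iff_ne_bot.2 hux)
        exact ⟨t, ht, trivial⟩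
      · refine ⟨|t| + 1, by positivity, lt_of_le_of_lt (EReal.coe_le_coe_iff.2 ?_) ht⟩
        have := neg_abs_le t
        linarith
      · exact ht.elim
    set ε : ℝ := 1 / (4 * B) with hε
    have hεpos : 0 < ε := by positivity
    have hεB : ε * B = 1 / 4 := by rw [hε]; field_simp
    set N : ℝ := C / ε with hN
    have hNpos : 0 < N := by positivity
    have hεN : ε * N = C := by rw [hN]; field_simp
    -- the open set where `u` is very negative
    let V : Set (EuclideanSpace ℂ (Fin n)) := {y | ∀ᶠ z in 𝓝 y, z ∈ D → u z < ((-N : ℝ) : EReal)}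
    have hVo : IsOpen V := by
      rw [isOpen_iff_mem_nhds]
      intro y hy
      exact eventually_eventually_nhds.2 hy
    have hFV : F ⊆ V := by
      intro y hy
      have h1 : uscReg u D y < ((-N : ℝ) : EReal) := by
        rw [huF y hy]; exact EReal.bot_lt_coe _
      have h2 := Filter.eventually_lt_of_limsup_lt h1
      exact eventually_nhdsWithin_iff.1 h2
    obtain ⟨χ, hχ0, hχ1, hχ⟩ := exists_continuous_zero_one_of_isClosed hVo.isClosed_compl
      hF.isClosed (by
        rw [Set.disjoint_left]
        intro y hy hyF
        exact hy (hFV hyF))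
    let f : EuclideanSpace ℂ (Fin n) → ℝ := fun z => -N * χ z
    have hf : Continuous f := continuous_const.mul χ.continuous
    have huf : ∀ z ∈ D, u z ≤ (f z : EReal) := by
      intro z hz
      by_cases hzV : z ∈ V
      · have h1 : u z < ((-N : ℝ) : EReal) := (Filter.Eventually.self_of_nhds hzV) hz
        refine h1.le.trans (EReal.coe_le_coe_iff.2 ?_)
        have := (hχ z).2
        simp only [f]
        nlinarith
      · have : f z = 0 := by
          have h2 : χ z = 0 := hχ0 hzV
          simp only [f, h2, mul_zero]
        rw [this]
        exact (hu0 z hz).le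
    obtain ⟨ψ, h1, h2, h3, h4⟩ := aux_walsh hDo hDb hreg hf hu huf
    have hψx : -B ≤ ψ x := by
      by_contra hcon
      push Not at hcon
      have h5 : ∀ᶠ y in 𝓝[D] x, ψ y < -B :=
        ((h1 x hxD).mono subset_closure).eventually_lt_const hcon
      have h6 : uscReg u D x ≤ ((-B : ℝ) : EReal) := by
        refine Filter.limsup_le_of_le (by isBoundedDefault) ?_
        filter_upwards [h5, self_mem_nhdsWithin] with y hy hyD
        exact (h4 y hyD).trans (EReal.coe_le_coe_iff.2 hy.le)
      exact absurd hBx (not_lt.2 h6)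
    have hψ0 : ∀ z ∈ closure D, ψ z ≤ 0 := by
      intro z hz
      refine (h3 z hz).trans ?_
      have := (hχ z).1
      simp only [f]
      nlinarith
    have hcont : ContinuousOn (fun z => ε * ψ z + (-1 / 2)) (closure D) :=
      (continuousOn_const.mul h1).add continuousOn_const
    refine ⟨{z | -1 < ε * ψ z + (-1 / 2)}, ?_, fun z => ε * ψ z + (-1 / 2), hcont,
      h2.affine hεpos _, ?_, ?_, ?_⟩
    · have h7 : ∀ᶠ y in 𝓝[K] x, -1 < ε * ψ y + (-1 / 2) := by
        refine ((hcont x hxD).mono (fun y hy => (hKsub hy).1)).eventually_const_lt ?_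
        nlinarith
      exact h7
    · intro z hz
      have := hψ0 z hz
      nlinarith
    · intro z hz
      have h8 := h3 z (hFsub hz).1
      have h9 : χ z = 1 := hχ1 hz
      simp only [f, h9, mul_one] at h8
      have := mul_le_mul_of_nonneg_left h8 hεpos.le
      linarith
    · intro z hz
      exact hz
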